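/- Let a = (u_1, u_2) be a CLT pair, i.e. a weak CLT pair with wt(a) = (ℓ(u_1) + ℓ(u_2))/2 − 1, where u_1, u_2 have lengths k_1, k_2 ≥ 2 with k_1 + k_2 even. Then either wt(a) = 1 + #E_a or wt(a) = #E_a. Moreover: (i) if wt(a) = 1 + #E_a, then G_a is a tree, N_e^{u_i} = 2 for all e ∈ E_{u_i} (i = 1, 2), and N_e^a = 2 for all e ∈ E_a except exactly one edge e_0 with N_{e_0}^a = 4; (ii) if wt(a) = #E_a, then for each i = 1, 2 there exists an edge e ∈ E_a with N_e^{u_i} = 1, and N_e^a = 2 for all e ∈ E_a. -/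

import Mathlib

/-- The list of edges (unordered pairs of adjacent letters) traversed by the word `w`. -/
def edgeList (w : List ℕ) : List (Sym2 ℕ) :=
  (w.zip w.tail).map fun p => s(p.1, p.2)

/-- The edge set `E_w` of the graph `G_w` of the word `w`. -/
def edgeFinset (w : List ℕ) : Finset (Sym2 ℕ) := (edgeList w).toFinset

/-- The traversal count `N_e^w`: the number of times the walk `w` traverses the edge `e`
(in either direction). -/
def trav (w : List ℕ) (e : Sym2 ℕ) : ℕ := (edgeList w).count e

/-- The support of a word: the set of letters appearing in it. -/
def wsupp (w : List ℕ) : Finset ℕ := w.toFinset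

/-- A word is a closed word starting at the letter `1`: a finite sequence of positive
integers whose first and last letters are both equal to `1`. -/
def IsClosedWordAtOne (w : List ℕ) : Prop :=
  w ≠ [] ∧ w.head? = some 1 ∧ w.getLast? = some 1 ∧ ∀ x ∈ w, 0 < x

/-- `(w₁, w₂)` is a weak CLT pair: both are closed words starting at `1`, every edge of the
combined graph is traversed at least twice in total, and the two words share an edge. -/
def IsWeakCLTPair (w₁ w₂ : List ℕ) : Prop :=
  IsClosedWordAtOne w₁ ∧ IsClosedWordAtOne w₂ ∧
    (∀ e ∈ edgeFinset w₁ ∪ edgeFinset w₂, 2 ≤ trav w₁ e + trav w₂ e) ∧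
    (edgeFinset w₁ ∩ edgeFinset w₂).Nonempty


/-- `(w₁, w₂)` is a CLT pair: a weak CLT pair with `wt(a) = (ℓ(w₁) + ℓ(w₂))/2 - 1`. -/
def IsCLTPair (w₁ w₂ : List ℕ) : Prop :=
  IsWeakCLTPair w₁ w₂ ∧
    ((wsupp w₁ ∪ wsupp w₂).card : ℚ) = ((w₁.length : ℚ) + w₂.length) / 2 - 1

/-- The graph `G_a` of the pair `a = (w₁, w₂)`, as a simple graph on `ℕ`
(its vertex set being the support of the pair). -/
def pairGraph (w₁ w₂ : List ℕ) : SimpleGraph ℕ :=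
  SimpleGraph.fromEdgeSet ((edgeFinset w₁ ∪ edgeFinset w₂ : Finset (Sym2 ℕ)) : Set (Sym2 ℕ))

/-- A simple graph on `ℕ` is a tree on the (finite) vertex set `s` if it is acyclic and all
vertices of `s` are connected to each other. -/
def IsTreeOn (G : SimpleGraph ℕ) (s : Finset ℕ) : Prop :=
  G.IsAcyclic ∧ ∀ x ∈ s, ∀ y ∈ s, G.Reachable x y

lemma edgeList_cons_cons (x y : ℕ) (t : List ℕ) :
    edgeList (x :: y :: t) = s(x, y) :: edgeList (y :: t) := rfl

lemma length_edgeList (w : List ℕ) : (edgeList w).length = w.length - 1 := by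
  simp [edgeList]

lemma sum_trav (w : List ℕ) (F : Finset (Sym2 ℕ)) (hF : edgeFinset w ⊆ F) :
    ∑ e ∈ F, trav w e = w.length - 1 := by
  have h := Multiset.sum_count_eq_card (s := F) (m := (edgeList w : Multiset (Sym2 ℕ)))
    (fun e he => hF (by simpa [edgeFinset] using he))
  simpa [trav, length_edgeList] using h

lemma mem_edgeFinset_iff_trav_pos {w : List ℕ} {e : Sym2 ℕ} :
    e ∈ edgeFinset w ↔ 0 < trav w e := by
  simp [edgeFinset, trav, List.count_pos_iff]

/-- All letters of a word are reachable from its first letter. -/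
lemma reachable_head_of_mem (F : Set (Sym2 ℕ)) (t : List ℕ) (x : ℕ)
    (hF : ∀ e ∈ edgeList (x :: t), e ∈ F) :
    ∀ y ∈ x :: t, (SimpleGraph.fromEdgeSet F).Reachable x y := by
  induction t generalizing x with
  | nil => simp
  | cons z t ih =>
    rw [edgeList_cons_cons] at hF
    have hxz : (SimpleGraph.fromEdgeSet F).Reachable x z := by
      by_cases hne : x = z
      · rw [hne]
      · exact SimpleGraph.Adj.reachable (by simp [hne, hF])
    intro y hy
    rcases List.mem_cons.mp hy with rfl | hy
    · rfl
    · exact hxz.trans (ih z (fun e he => hF e (List.mem_cons_of_mem _ he)) y hy)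

/-- If crossing `e` flips `c` while every other step preserves it, the parity of the number of
crossings of `e` is read off from the endpoints of the word. -/
lemma even_trav_iff (c : ℕ → Prop) (e : Sym2 ℕ) (t : List ℕ) (x : ℕ)
    (hc : ∀ p q, s(p, q) ∈ edgeList (x :: t) → ((c p ↔ c q) ↔ s(p, q) ≠ e)) :
    Even (trav (x :: t) e) ↔ (c x ↔ c ((x :: t).getLast (List.cons_ne_nil x t))) := by
  induction t generalizing x with
  | nil => simp [trav, edgeList]
  | cons y t ih =>
    rw [edgeList_cons_cons] at hc
    have hxy := hc x y List.mem_cons_self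
    have h := ih y fun p q hpq => hc p q (List.mem_cons_of_mem _ hpq)
    rw [List.getLast_cons_cons]
    by_cases he : s(x, y) = e
    · have : trav (x :: y :: t) e = trav (y :: t) e + 1 := by
        simp [trav, edgeList_cons_cons, he]
      rw [this, Nat.even_add_one, h]
      tauto
    · have : trav (x :: y :: t) e = trav (y :: t) e := by
        simp [trav, edgeList_cons_cons, he]
      rw [this, h]
      tauto

lemma SimpleGraph.Reachable.exists_adj_dist_add_one {V : Type*} {G : SimpleGraph V} {r x : V}
    (h : G.Reachable r x) (hne : x ≠ r) : ∃ y, G.Adj x y ∧ G.dist r x = G.dist r y + 1 := by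
  obtain ⟨p, hp⟩ := h.symm.exists_walk_length_eq_dist
  cases p with
  | nil => exact absurd rfl hne
  | @cons _ y _ hadj q =>
    refine ⟨y, hadj, ?_⟩
    have h1 : G.dist r y ≤ q.length := by
      rw [SimpleGraph.dist_comm]; exact SimpleGraph.dist_le q
    have h2 : G.dist r x ≤ G.dist r y + 1 := by
      obtain ⟨p', hp'⟩ := (h.trans hadj.reachable).exists_walk_length_eq_dist
      rw [← hp']
      simpa using SimpleGraph.dist_le (p'.concat hadj.symm)
    rw [SimpleGraph.Walk.length_cons, SimpleGraph.dist_comm] at hp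
    omega

/-- A set of vertices reachable from `r` through the edges in `F` has at most `#F + 1` elements. -/
lemma card_le_of_forall_reachable {V : Type*} [DecidableEq V] (F : Finset (Sym2 V)) (S : Finset V)
    (r : V) (h : ∀ x ∈ S, (SimpleGraph.fromEdgeSet (F : Set (Sym2 V))).Reachable r x) :
    S.card ≤ F.card + 1 := by
  set G := SimpleGraph.fromEdgeSet (F : Set (Sym2 V)) with hG
  have hp : ∀ x, ∃ y, x ∈ S.erase r → G.Adj x y ∧ G.dist r x = G.dist r y + 1 := by
    intro x
    by_cases hx : x ∈ S.erase r
    · obtain ⟨y, hy⟩ := (h x (Finset.mem_of_mem_erase hx)).exists_adj_dist_add_one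
        (Finset.ne_of_mem_erase hx)
      exact ⟨y, fun _ => hy⟩
    · exact ⟨x, fun hx' => absurd hx' hx⟩
  choose f hf using hp
  have hcard : (S.erase r).card ≤ F.card := by
    refine Finset.card_le_card_of_injOn (fun x => s(x, f x)) ?_ ?_
    · intro x hx
      have := (hf x hx).1
      rw [hG, SimpleGraph.fromEdgeSet_adj] at this
      exact this.1
    · intro x hx y hy hxy
      rcases Sym2.eq_iff.mp hxy with h' | ⟨h₁, h₂⟩
      · exact h'.1
      · have hx' := (hf x hx).2
        have hy' := (hf y hy).2
        rw [h₂] at hx'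
        rw [← h₁] at hy'
        omega
  have := Finset.pred_card_le_card_erase (s := S) (a := r)
  omega

/-- Deleting an edge whose endpoints stay connected does not change reachability. -/
lemma reachable_erase_of_reachable {V : Type*} [DecidableEq V] (F : Finset (Sym2 V)) (a b : V)
    (hab : (SimpleGraph.fromEdgeSet (F.erase s(a, b) : Set (Sym2 V))).Reachable a b)
    {x y : V} (h : (SimpleGraph.fromEdgeSet (F : Set (Sym2 V))).Reachable x y) :
    (SimpleGraph.fromEdgeSet (F.erase s(a, b) : Set (Sym2 V))).Reachable x y := by
  obtain ⟨p⟩ := h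
  induction p with
  | nil => rfl
  | @cons u v _ hadj _ ih =>
    refine SimpleGraph.Reachable.trans ?_ ih
    rw [SimpleGraph.fromEdgeSet_adj] at hadj
    by_cases he : s(u, v) = s(a, b)
    · rcases Sym2.eq_iff.mp he with ⟨rfl, rfl⟩ | ⟨rfl, rfl⟩
      · exact hab
      · exact hab.symm
    · refine SimpleGraph.Adj.reachable ?_
      rw [SimpleGraph.fromEdgeSet_adj]
      exact ⟨by simpa [he] using hadj.1, hadj.2⟩

/-- In a connected graph with one more vertex than edges, deleting an edge separates its
endpoints. -/
lemma not_reachable_erase {V : Type*} [DecidableEq V] (F : Finset (Sym2 V)) (S : Finset V) (r : V)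
    (h : ∀ x ∈ S, (SimpleGraph.fromEdgeSet (F : Set (Sym2 V))).Reachable r x)
    (hcard : S.card = 1 + F.card) (a b : V) (hab : s(a, b) ∈ F) :
    ¬ (SimpleGraph.fromEdgeSet (F.erase s(a, b) : Set (Sym2 V))).Reachable a b := by
  intro hr
  have h1 := card_le_of_forall_reachable (F.erase s(a, b)) S r
    fun x hx => reachable_erase_of_reachable F a b hr (h x hx)
  have h2 := Finset.card_erase_add_one hab
  omega

/-- A closed word along edges of `F` crosses every separating edge an even number of times. -/
lemma even_trav_of_separating (F : Finset (Sym2 ℕ))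
    (hF : ∀ a b, s(a, b) ∈ F →
      ¬ (SimpleGraph.fromEdgeSet (F.erase s(a, b) : Set (Sym2 ℕ))).Reachable a b)
    (w : List ℕ) (hw : IsClosedWordAtOne w) (hwF : edgeFinset w ⊆ F)
    (e : Sym2 ℕ) (he : e ∈ F) : Even (trav w e) := by
  obtain ⟨hne, hhead, hlast, -⟩ := hw
  obtain ⟨x, t, rfl⟩ := List.exists_cons_of_ne_nil hne
  induction e using Sym2.ind with
  | _ a b =>
    set G := SimpleGraph.fromEdgeSet (F.erase s(a, b) : Set (Sym2 ℕ)) with hG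
    refine (even_trav_iff (fun z => G.Reachable a z) _ t x ?_).mpr ?_
    · intro p q hpq
      have hpqF : s(p, q) ∈ F := hwF (by simpa [edgeFinset] using hpq)
      by_cases hE : s(p, q) = s(a, b)
      · have hab := hF a b he
        rcases Sym2.eq_iff.mp hE with ⟨rfl, rfl⟩ | ⟨rfl, rfl⟩
        · simp only [SimpleGraph.Reachable.refl, true_iff, ne_eq, not_true_eq_false, iff_false]
          exact hab
        · simp only [SimpleGraph.Reachable.refl, iff_true, ne_eq, hE, not_true_eq_false, iff_false]
          exact hab
      · have hpq' : p ≠ q := by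
          rintro rfl
          exact hF p p hpqF (SimpleGraph.Reachable.refl _)
        have hadj : G.Adj p q := by
          rw [hG, SimpleGraph.fromEdgeSet_adj]
          exact ⟨by simpa [hE] using hpqF, hpq'⟩
        simp only [ne_eq, hE, not_false_eq_true, iff_true]
        exact ⟨fun h => h.trans hadj.reachable, fun h => h.trans hadj.symm.reachable⟩
    · rw [List.getLast?_eq_getLast_of_ne_nil (List.cons_ne_nil x t)] at hlast
      simp only [List.head?_cons, Option.some.injEq] at hhead hlast
      rw [hlast, hhead]

lemma isAcyclic_of_separating {V : Type*} [DecidableEq V] (F : Finset (Sym2 V))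
    (hF : ∀ a b, s(a, b) ∈ F →
      ¬ (SimpleGraph.fromEdgeSet (F.erase s(a, b) : Set (Sym2 V))).Reachable a b) :
    (SimpleGraph.fromEdgeSet (F : Set (Sym2 V))).IsAcyclic := by
  rw [SimpleGraph.isAcyclic_iff_forall_adj_isBridge]
  intro v w hvw
  have hmem : s(v, w) ∈ F := (SimpleGraph.fromEdgeSet_adj _).mp hvw |>.1
  rw [SimpleGraph.isBridge_iff]
  refine fun hr => hF v w hmem (hr.mono ?_)
  intro p q hpq
  simp_all

/-- Properties of CLT pairs: if `(u₁, u₂)` is a CLT pair of words of lengths `k₁, k₂ ≥ 2`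
with `k₁ + k₂` even, then `wt(a) = 1 + #E_a` or `wt(a) = #E_a`; in the first case `G_a` is a
tree, each word traverses each of its edges exactly twice, and all edges of `a` are
traversed exactly twice except exactly one edge traversed four times; in the second case
each word traverses some edge of `a` exactly once, and all edges of `a` are traversed
exactly twice. -/
theorem CLT_pair_properties (u₁ u₂ : List ℕ) (k₁ k₂ : ℕ)
    (hl₁ : u₁.length = k₁) (hl₂ : u₂.length = k₂)
    (hk₁ : 2 ≤ k₁) (hk₂ : 2 ≤ k₂) (hkeven : Even (k₁ + k₂))
    (h : IsCLTPair u₁ u₂) :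
    ((wsupp u₁ ∪ wsupp u₂).card = 1 + (edgeFinset u₁ ∪ edgeFinset u₂).card ∨
      (wsupp u₁ ∪ wsupp u₂).card = (edgeFinset u₁ ∪ edgeFinset u₂).card) ∧
    ((wsupp u₁ ∪ wsupp u₂).card = 1 + (edgeFinset u₁ ∪ edgeFinset u₂).card →
      IsTreeOn (pairGraph u₁ u₂) (wsupp u₁ ∪ wsupp u₂) ∧
      (∀ e ∈ edgeFinset u₁, trav u₁ e = 2) ∧ (∀ e ∈ edgeFinset u₂, trav u₂ e = 2) ∧
      ∃ e₀ ∈ edgeFinset u₁ ∪ edgeFinset u₂, trav u₁ e₀ + trav u₂ e₀ = 4 ∧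
        ∀ e ∈ edgeFinset u₁ ∪ edgeFinset u₂, e ≠ e₀ → trav u₁ e + trav u₂ e = 2) ∧
    ((wsupp u₁ ∪ wsupp u₂).card = (edgeFinset u₁ ∪ edgeFinset u₂).card →
      (∃ e ∈ edgeFinset u₁ ∪ edgeFinset u₂, trav u₁ e = 1) ∧
      (∃ e ∈ edgeFinset u₁ ∪ edgeFinset u₂, trav u₂ e = 1) ∧
      ∀ e ∈ edgeFinset u₁ ∪ edgeFinset u₂, trav u₁ e + trav u₂ e = 2) := by
  obtain ⟨⟨hc₁, hc₂, htwo, e₁, he₁⟩, hwt⟩ := h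
  set F := edgeFinset u₁ ∪ edgeFinset u₂ with hFdef
  set S := wsupp u₁ ∪ wsupp u₂ with hSdef
  have hF₁ : edgeFinset u₁ ⊆ F := Finset.subset_union_left
  have hF₂ : edgeFinset u₂ ⊆ F := Finset.subset_union_right
  rw [Finset.mem_inter] at he₁
  have he₁F : e₁ ∈ F := hF₁ he₁.1
  have hpos₁ := mem_edgeFinset_iff_trav_pos.mp he₁.1
  have hpos₂ := mem_edgeFinset_iff_trav_pos.mp he₁.2
  have hsum : ∑ e ∈ F, (trav u₁ e + trav u₂ e) = 2 * S.card := by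
    rw [Finset.sum_add_distrib, sum_trav u₁ F hF₁, sum_trav u₂ F hF₂]
    have : S.card * 2 + 2 = u₁.length + u₂.length := by
      have : (S.card : ℚ) * 2 + 2 = u₁.length + u₂.length := by linarith
      exact_mod_cast this
    omega
  have hexcess : ∑ e ∈ F, (trav u₁ e + trav u₂ e - 2) + 2 * F.card = 2 * S.card := by
    rw [← hsum, mul_comm, ← smul_eq_mul, ← Finset.sum_const, ← Finset.sum_add_distrib]
    exact Finset.sum_congr rfl fun e he => Nat.sub_add_cancel (htwo e he)
  have hreach_word : ∀ w, IsClosedWordAtOne w → edgeFinset w ⊆ F → ∀ x ∈ wsupp w,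
      (SimpleGraph.fromEdgeSet (F : Set (Sym2 ℕ))).Reachable 1 x := by
    rintro w ⟨hne, hhead, -, -⟩ hwF x hx
    obtain ⟨y, t, rfl⟩ := List.exists_cons_of_ne_nil hne
    obtain rfl : y = 1 := by simpa using hhead
    exact reachable_head_of_mem _ t 1 (fun e he => hwF (by simpa [edgeFinset] using he)) x
      (by simpa [wsupp] using hx)
  have hreach : ∀ x ∈ S, (SimpleGraph.fromEdgeSet (F : Set (Sym2 ℕ))).Reachable 1 x := by
    intro x hx
    rcases Finset.mem_union.mp hx with hx | hx
    · exact hreach_word u₁ hc₁ hF₁ x hx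
    · exact hreach_word u₂ hc₂ hF₂ x hx
  have hle := card_le_of_forall_reachable F S 1 hreach
  refine ⟨by omega, fun hcard => ?_, fun hcard => ?_⟩
  · have hsep := not_reachable_erase F S 1 hreach hcard
    have heven₁ := even_trav_of_separating F hsep u₁ hc₁ hF₁
    have heven₂ := even_trav_of_separating F hsep u₂ hc₂ hF₂
    have hsplit := Finset.add_sum_erase F (fun e => trav u₁ e + trav u₂ e - 2) he₁F
    have h₁ := (heven₁ e₁ he₁F).two_dvd
    have h₂ := (heven₂ e₁ he₁F).two_dvd
    have hzero : ∑ e ∈ F.erase e₁, (trav u₁ e + trav u₂ e - 2) = 0 := by grind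
    have hrest : ∀ e ∈ F, e ≠ e₁ → trav u₁ e + trav u₂ e = 2 := by
      intro e he hne
      have := Finset.sum_eq_zero_iff.mp hzero e (Finset.mem_erase.mpr ⟨hne, he⟩)
      have := htwo e he
      omega
    have hval : trav u₁ e₁ = 2 ∧ trav u₂ e₁ = 2 := by grind
    refine ⟨⟨isAcyclic_of_separating F hsep, fun x hx y hy => (hreach x hx).symm.trans
      (hreach y hy)⟩, fun e he => ?_, fun e he => ?_, e₁, he₁F, by omega, hrest⟩
    · by_cases hne : e = e₁
      · rw [hne, hval.1]
      · have := hrest e (hF₁ he) hne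
        have := mem_edgeFinset_iff_trav_pos.mp he
        have := (heven₁ e (hF₁ he)).two_dvd
        omega
    · by_cases hne : e = e₁
      · rw [hne, hval.2]
      · have := hrest e (hF₂ he) hne
        have := mem_edgeFinset_iff_trav_pos.mp he
        have := (heven₂ e (hF₂ he)).two_dvd
        omega
  · have hzero : ∑ e ∈ F, (trav u₁ e + trav u₂ e - 2) = 0 := by omega
    have hall : ∀ e ∈ F, trav u₁ e + trav u₂ e = 2 := by
      intro e he
      have := Finset.sum_eq_zero_iff.mp hzero e he
      have := htwo e he
      omega
    have := hall e₁ he₁F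
    exact ⟨⟨e₁, he₁F, by omega⟩, ⟨e₁, he₁F, by omega⟩, hall⟩
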